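/- Let p be a prime and G a finite group possessing a normal Sylow p-subgroup P such that the quotient G/P is cyclic. Then there exists a normal subgroup H of G whose order is prime to p and whose index satisfies [G : H] ≤ |P| · |Aut(P)|, where Aut(P) is the automorphism group of P. -/

import Mathlib

/-- If `Q` is a complement of the normal subgroup `N`, then the elements of `Q` acting trivially
on `N` by conjugation form a normal subgroup of the whole group. -/
theorem Subgroup.IsComplement'.normal_inf_ker_conjNormal {G : Type*} [Group G]
    {N Q : Subgroup G} [N.Normal] (h : N.IsComplement' Q) :
    (Q ⊓ (MulAut.conjNormal : G →* MulAut N).ker).Normal := by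
  refine ⟨fun n hn g => ?_⟩
  obtain ⟨⟨x, y⟩, rfl⟩ := h.2 g
  have hm : (y : G) * n * (y : G)⁻¹ ∈ Q ⊓ (MulAut.conjNormal : G →* MulAut N).ker :=
    ⟨Q.mul_mem (Q.mul_mem y.2 hn.1) (Q.inv_mem y.2), Subgroup.Normal.conj_mem inferInstance n hn.2 y⟩
  generalize hz : (y : G) * n * (y : G)⁻¹ = z at hm
  have hc : z * (x : G) * z⁻¹ = x := by
    have := congrArg (fun f : MulAut N => (f x : G)) (MonoidHom.mem_ker.1 hm.2)
    simpa using this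
  have hxz : (x : G) * y * n * ((x : G) * y)⁻¹ = z := by
    calc (x : G) * y * n * ((x : G) * y)⁻¹ = x * (y * n * (y : G)⁻¹) * (x : G)⁻¹ := by group
      _ = x * z * (x : G)⁻¹ := by rw [hz]
      _ = z := by rw [← mul_inv_eq_iff_eq_mul.1 hc, mul_inv_cancel_right]
  simpa only [hxz] using hm



/-- Let `p` be a prime and `G` a finite group with a normal Sylow `p`-subgroup `P`
such that `G ⧸ P` is cyclic. Then there is a normal subgroup `H` of `G` of order
prime to `p` with `[G : H] ≤ |P| * |Aut(P)|`. -/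
theorem stmt4 (p : ℕ) [Fact p.Prime] (G : Type*) [Group G] [Finite G]
    (P : Sylow p G) (hP : (P : Subgroup G).Normal)
    (hcyc : IsCyclic (G ⧸ (P : Subgroup G))) :
    ∃ H : Subgroup G, H.Normal ∧ (Nat.card H).Coprime p ∧
      H.index ≤ Nat.card (P : Subgroup G) * Nat.card (MulAut (P : Subgroup G)) := by
  obtain ⟨Q, hQ⟩ := Subgroup.exists_right_complement'_of_coprime P.card_coprime_index
  refine ⟨Q ⊓ (MulAut.conjNormal : G →* MulAut (P : Subgroup G)).ker,
    hQ.normal_inf_ker_conjNormal, ?_, ?_⟩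
  · refine Nat.Coprime.coprime_dvd_left (Subgroup.card_dvd_of_le inf_le_left) ?_
    rw [← hQ.symm.index_eq_card]
    exact ((Nat.Prime.coprime_iff_not_dvd Fact.out).2 P.not_dvd_index).symm
  · refine Subgroup.index_inf_le.trans ?_
    rw [hQ.index_eq_card, Subgroup.index_ker]
    exact Nat.mul_le_mul_left _ (Subgroup.card_le_card_group _)
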